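/- Let n ∈ ℕ and let p ≥ 1 be an integer. The pushforward of the cone probability measure μ_p^{n+p} on 𝕊_p^{n+p−1} ⊆ ℝ^{n+p} under the orthogonal projection onto the first n coordinates equals the uniform probability measure ν_p^n on 𝔹_p^n. -/

import Mathlib

open MeasureTheory Set
open scoped ENNReal

/-- The `p`-norm on `ℝ^m`. -/
noncomputable def pnorm {m : ℕ} (p : ℝ) (x : Fin m → ℝ) : ℝ :=
  (∑ i, |x i| ^ p) ^ (1 / p)

/-- The unit ball `𝔹_p^m`. -/
def pBall (m : ℕ) (p : ℝ) : Set (Fin m → ℝ) := {x | pnorm p x ≤ 1}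

/-- The unit sphere `𝕊_p^{m-1}`. -/
def pSphere (m : ℕ) (p : ℝ) : Set (Fin m → ℝ) := {x | pnorm p x = 1}

/-- The cone `[0,1]A = {r • a : r ∈ [0,1], a ∈ A}`. -/
def coneSet {m : ℕ} (A : Set (Fin m → ℝ)) : Set (Fin m → ℝ) :=
  Set.image2 (· • ·) (Icc (0 : ℝ) 1) A

/-- The uniform probability measure `ν_p^n` on `𝔹_p^n`. -/
noncomputable def nuMeasure (n : ℕ) (p : ℝ) : Measure (Fin n → ℝ) :=
  (volume (pBall n p))⁻¹ • volume.restrict (pBall n p)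

/-- The sum `∑ |x i| ^ p`, i.e. the `p`-th power of the `p`-norm. -/
noncomputable def psum {m : ℕ} (p : ℝ) (x : Fin m → ℝ) : ℝ := ∑ i, |x i| ^ p

section psum

variable {m : ℕ} {p : ℝ}

lemma psum_nonneg (x : Fin m → ℝ) : 0 ≤ psum p x :=
  Finset.sum_nonneg fun _ _ => Real.rpow_nonneg (abs_nonneg _) _

lemma measurable_psum : Measurable (psum p : (Fin m → ℝ) → ℝ) := by
  unfold psum
  fun_prop

lemma psum_smul {r : ℝ} (hr : 0 ≤ r) (x : Fin m → ℝ) : psum p (r • x) = r ^ p * psum p x := by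
  simp [psum, Finset.mul_sum, abs_mul, abs_of_nonneg hr, Real.mul_rpow hr (abs_nonneg _)]

lemma psum_rpow_smul (hp : 0 < p) {t : ℝ} (ht : 0 ≤ t) (x : Fin m → ℝ) :
    psum p (t ^ (1 / p) • x) = t * psum p x := by
  rw [psum_smul (Real.rpow_nonneg ht _), ← Real.rpow_mul ht, one_div_mul_cancel hp.ne',
    Real.rpow_one]

lemma psum_eq_zero_iff (hp : 0 < p) {x : Fin m → ℝ} : psum p x = 0 ↔ x = 0 := by
  rw [psum, Finset.sum_eq_zero_iff_of_nonneg
    fun _ _ => Real.rpow_nonneg (abs_nonneg _) _]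
  simp [Real.rpow_eq_zero (abs_nonneg _) hp.ne', funext_iff]

lemma ae_psum_pos (hm : 1 ≤ m) (hp : 0 < p) : ∀ᵐ x : Fin m → ℝ, 0 < psum p x := by
  have : Nonempty (Fin m) := ⟨⟨0, hm⟩⟩
  have h0 : ∀ᵐ x : Fin m → ℝ, x ≠ 0 := by
    simp [ae_iff]
  filter_upwards [h0] with x hx
  exact (psum_nonneg x).lt_of_ne fun h => hx ((psum_eq_zero_iff hp).1 h.symm)

lemma mem_pBall_iff (hp : 0 < p) {x : Fin m → ℝ} : x ∈ pBall m p ↔ psum p x ≤ 1 := by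
  change psum p x ^ (1 / p) ≤ 1 ↔ _
  rw [← Real.rpow_le_rpow_iff (psum_nonneg x) zero_le_one (one_div_pos.2 hp), Real.one_rpow]

lemma mem_pSphere_iff (hp : 0 < p) {x : Fin m → ℝ} : x ∈ pSphere m p ↔ psum p x = 1 := by
  change psum p x ^ (1 / p) = 1 ↔ _
  rw [← Real.rpow_left_inj (psum_nonneg x) zero_le_one (one_div_pos.2 hp).ne', Real.one_rpow]

lemma measurableSet_pBall (hp : 0 < p) : MeasurableSet (pBall m p) := by
  have : pBall m p = {x | psum p x ≤ 1} := Set.ext fun x => mem_pBall_iff hp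
  rw [this]
  exact measurableSet_le measurable_psum measurable_const

lemma measurableSet_pSphere (hp : 0 < p) : MeasurableSet (pSphere m p) := by
  have : pSphere m p = {x | psum p x = 1} := Set.ext fun x => mem_pSphere_iff hp
  rw [this]
  exact measurableSet_eq_fun measurable_psum measurable_const

lemma volume_pBall (hm : 1 ≤ m) (hp : 1 ≤ p) :
    volume (pBall m p) =
      .ofReal ((2 * Real.Gamma (1 / p + 1)) ^ m / Real.Gamma (m / p + 1)) := by
  have : Nonempty (Fin m) := ⟨⟨0, hm⟩⟩
  simpa [pBall, pnorm] using MeasureTheory.volume_sum_rpow_le (Fin m) hp 1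

lemma volume_pBall_ne_zero (hm : 1 ≤ m) (hp : 1 ≤ p) : volume (pBall m p) ≠ 0 := by
  have hp0 : 0 < p := by linarith
  rw [volume_pBall hm hp]
  have h1 := Real.Gamma_pos_of_pos (s := 1 / p + 1) (by positivity)
  have h2 := Real.Gamma_pos_of_pos (s := m / p + 1) (by positivity)
  exact (ENNReal.ofReal_pos.2 (by positivity)).ne'

lemma volume_pBall_ne_top (hm : 1 ≤ m) (hp : 1 ≤ p) : volume (pBall m p) ≠ ∞ := by
  rw [volume_pBall hm hp]
  exact ENNReal.ofReal_ne_top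

end psum

/-- In dimension `p`, sublevel sets of `∑ |y i| ^ p` have volume linear in the level. -/
lemma volume_psum_le {p : ℕ} (hp : 1 ≤ p) (a : ℝ) :
    volume {y : Fin p → ℝ | psum (p : ℝ) y ≤ a} =
      volume (pBall p (p : ℝ)) * ENNReal.ofReal a := by
  have hp1 : (1 : ℝ) ≤ p := by exact_mod_cast hp
  have hp0 : (0 : ℝ) < p := by linarith
  rcases lt_or_ge a 0 with ha | ha
  · rw [ENNReal.ofReal_of_nonpos ha.le, mul_zero]
    convert! measure_empty (μ := volume)
    ext y
    simpa using ha.trans_le (psum_nonneg y)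
  · have : Nonempty (Fin p) := ⟨⟨0, hp⟩⟩
    have h := MeasureTheory.volume_sum_rpow_le (Fin p) hp1 (a ^ (1 / (p : ℝ)))
    rw [Fintype.card_fin, ← volume_pBall hp hp1, ← ENNReal.ofReal_pow (by positivity),
      ← Real.rpow_natCast, ← Real.rpow_mul ha, one_div_mul_cancel hp0.ne', Real.rpow_one] at h
    rw [mul_comm, ← h]
    congr 1
    ext y
    exact (Real.rpow_le_rpow_iff (psum_nonneg y) ha (by positivity)).symm

lemma map_add_psum {p : ℕ} (hp : 1 ≤ p) (b : ℝ) :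
    Measure.map (fun y : Fin p → ℝ => b + psum (p : ℝ) y) volume =
      volume (pBall p (p : ℝ)) • volume.restrict (Ici b) := by
  have hp1 : (1 : ℝ) ≤ p := by exact_mod_cast hp
  have key (a : ℝ) : Measure.map (fun y : Fin p → ℝ => b + psum (p : ℝ) y) volume (Iic a) =
      volume (pBall p (p : ℝ)) * ENNReal.ofReal (a - b) := by
    rw [Measure.map_apply (measurable_psum.const_add b) measurableSet_Iic, ← volume_psum_le hp]
    congr 1
    ext y
    simp [le_sub_iff_add_le']
  refine Measure.ext_of_generateFrom_of_iUnion (range Iic) (fun k : ℕ => Iic (k : ℝ))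
    (BorelSpace.measurable_eq.trans (borel_eq_generateFrom_Iic ℝ)) isPiSystem_Iic ?_ ?_ ?_ ?_
  · exact eq_univ_of_forall fun x => mem_iUnion.2 (exists_nat_ge x)
  · exact fun i => mem_range_self _
  · intro i
    rw [key]
    exact ENNReal.mul_ne_top (volume_pBall_ne_top hp hp1) ENNReal.ofReal_ne_top
  · rintro _ ⟨a, rfl⟩
    rw [key, Measure.smul_apply, Measure.restrict_apply measurableSet_Iic, Iic_inter_Ici,
      Real.volume_Icc, smul_eq_mul]

lemma measurePreserving_append (n p : ℕ) :
    MeasurePreserving (fun q : (Fin n → ℝ) × (Fin p → ℝ) => Fin.append q.1 q.2)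
      (volume.prod volume) volume := by
  have hm : Measurable (fun q : (Fin n → ℝ) × (Fin p → ℝ) => Fin.append q.1 q.2) := by
    refine measurable_pi_iff.2 fun i => ?_
    refine Fin.addCases (fun i => ?_) (fun i => ?_) i
    · simp only [Fin.append_left]
      fun_prop
    · simp only [Fin.append_right]
      fun_prop
  refine ⟨hm, (Measure.pi_eq fun s hs => ?_).symm⟩
  rw [Measure.map_apply hm (.univ_pi hs)]
  have : (fun q : (Fin n → ℝ) × (Fin p → ℝ) => Fin.append q.1 q.2) ⁻¹' univ.pi s =
      (univ.pi fun i => s (Fin.castAdd p i)) ×ˢ (univ.pi fun i => s (Fin.natAdd n i)) := by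
    ext q
    simp [Set.mem_pi, Fin.forall_fin_add]
  rw [this, Measure.prod_prod, volume_pi_pi, volume_pi_pi, Fin.prod_univ_add]

lemma psum_append {n m : ℕ} {p : ℝ} (x : Fin n → ℝ) (y : Fin m → ℝ) :
    psum p (Fin.append x y) = psum p x + psum p y := by
  simp [psum, Fin.sum_univ_add]

/-- The nonzero points of the unit ball whose radial projection to the sphere has its first `n`
coordinates in `A`. -/
def puncturedCone (n m : ℕ) (p : ℝ) (A : Set (Fin n → ℝ)) : Set (Fin (n + m) → ℝ) :=
  {z | (0 < psum p z ∧ psum p z ≤ 1) ∧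
    ((psum p z)⁻¹ ^ (1 / p)) • (fun i : Fin n => z (Fin.castAdd m i)) ∈ A}

lemma measurableSet_puncturedCone {n m : ℕ} {p : ℝ} {A : Set (Fin n → ℝ)} (hA : MeasurableSet A) :
    MeasurableSet (puncturedCone n m p A) := by
  have hN := measurable_psum (m := n + m) (p := p)
  refine ((measurableSet_lt measurable_const hN).inter
    (measurableSet_le hN measurable_const)).inter ?_
  refine hA.preimage ?_
  fun_prop

lemma coneSet_ae_eq {n m : ℕ} {p : ℝ} (hn : 1 ≤ n) (hp : 0 < p) (A : Set (Fin n → ℝ)) :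
    coneSet ((fun (z : Fin (n + m) → ℝ) (i : Fin n) => z (Fin.castAdd m i)) ⁻¹' A ∩
      pSphere (n + m) p) =ᵐ[volume] puncturedCone n m p A := by
  filter_upwards [ae_psum_pos (by omega) hp] with z hN
  refine propext ⟨?_, ?_⟩
  · rintro ⟨r, ⟨hr0, hr1⟩, a, ⟨haA, haS⟩, rfl⟩
    rw [mem_pSphere_iff hp] at haS
    have hra : psum p (r • a) = r ^ p := by rw [psum_smul hr0, haS, mul_one]
    have hr : r ≠ 0 := by
      rintro rfl
      exact hN.ne' ((psum_eq_zero_iff hp).2 (zero_smul ℝ a))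
    refine ⟨⟨hN, ?_⟩, ?_⟩
    · change psum p (r • a) ≤ 1
      rw [hra]
      exact Real.rpow_le_one hr0 hr1 hp.le
    · change (psum p (r • a))⁻¹ ^ (1 / p) • (fun i : Fin n => (r • a) (Fin.castAdd m i)) ∈ A
      rw [hra, Real.inv_rpow (by positivity), ← Real.rpow_mul hr0, mul_one_div_cancel hp.ne',
        Real.rpow_one]
      have hcoord : (r⁻¹ • fun i : Fin n => (r • a) (Fin.castAdd m i)) =
          fun i => a (Fin.castAdd m i) := by
        ext i
        simp [hr]
      rw [hcoord]
      exact haA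
  · rintro ⟨⟨-, h1⟩, hA⟩
    refine ⟨psum p z ^ (1 / p), ⟨by positivity, Real.rpow_le_one hN.le h1 (by positivity)⟩,
      (psum p z)⁻¹ ^ (1 / p) • z, ⟨hA, ?_⟩, ?_⟩
    · rw [mem_pSphere_iff hp, psum_rpow_smul hp (by positivity), inv_mul_cancel₀ hN.ne']
    · simp only [smul_smul]
      rw [← Real.mul_rpow hN.le (by positivity), mul_inv_cancel₀ hN.ne', Real.one_rpow, one_smul]

/-- The constant relating the volume of a cone over a set of the sphere `𝕊_p^{n+p-1}` to the volume
of the projection of that set. -/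
noncomputable def coneConst (n p : ℕ) : ℝ≥0∞ :=
  volume (pBall p (p : ℝ)) *
    ∫⁻ t in Ioc (0 : ℝ) 1, ENNReal.ofReal |((t⁻¹ ^ (1 / (p : ℝ))) ^ n)⁻¹|

lemma volume_puncturedCone {n p : ℕ} (hp : 1 ≤ p) {A : Set (Fin n → ℝ)} (hA : MeasurableSet A) :
    volume (puncturedCone n p (p : ℝ) A) = coneConst n p * volume (A ∩ pBall n (p : ℝ)) := by
  have hp0 : (0 : ℝ) < p := by exact_mod_cast hp
  set W : Set ((Fin n → ℝ) × ℝ) :=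
    {q | ((0 < q.2 ∧ q.2 ≤ 1) ∧ q.2⁻¹ ^ (1 / (p : ℝ)) • q.1 ∈ A) ∧ psum (p : ℝ) q.1 ≤ q.2}
    with hW
  have hWm : MeasurableSet W := by
    refine MeasurableSet.inter (MeasurableSet.inter ((measurableSet_lt measurable_const
      measurable_snd).inter (measurableSet_le measurable_snd measurable_const)) ?_)
      (measurableSet_le (measurable_psum.comp measurable_fst) measurable_snd)
    refine hA.preimage ?_
    fun_prop
  have hfiber (x : Fin n → ℝ) :
      volume {y : Fin p → ℝ | Fin.append x y ∈ puncturedCone n p (p : ℝ) A} =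
        volume (pBall p (p : ℝ)) * volume (Prod.mk x ⁻¹' W) := by
    set U : Set ℝ := {t | (0 < t ∧ t ≤ 1) ∧ t⁻¹ ^ (1 / (p : ℝ)) • x ∈ A} with hU
    have hUm : MeasurableSet U := by
      refine MeasurableSet.inter ((measurableSet_lt measurable_const
        measurable_id).inter (measurableSet_le measurable_id measurable_const)) ?_
      refine hA.preimage ?_
      fun_prop
    have h1 : {y : Fin p → ℝ | Fin.append x y ∈ puncturedCone n p (p : ℝ) A} =
        (fun y => psum (p : ℝ) x + psum (p : ℝ) y) ⁻¹' U := by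
      ext y
      simp [puncturedCone, psum_append, hU]
    have h2 : Prod.mk x ⁻¹' W = U ∩ Ici (psum (p : ℝ) x) := rfl
    rw [h1, h2, ← Measure.map_apply (measurable_psum.const_add _) hUm, map_add_psum hp,
      Measure.smul_apply, Measure.restrict_apply hUm, smul_eq_mul]
  have hslice (t : ℝ) : volume ((fun x => (x, t)) ⁻¹' W) =
      (Ioc (0 : ℝ) 1).indicator (fun t => ENNReal.ofReal |((t⁻¹ ^ (1 / (p : ℝ))) ^ n)⁻¹|) t *
        volume (A ∩ pBall n (p : ℝ)) := by
    by_cases ht : t ∈ Ioc (0 : ℝ) 1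
    · have ht0 : 0 < t := ht.1
      have h1 : (fun x => (x, t)) ⁻¹' W =
          ((t⁻¹ ^ (1 / (p : ℝ))) • ·) ⁻¹' (A ∩ pBall n (p : ℝ)) := by
        ext x
        simp only [hW, mem_preimage, mem_ofPred_eq, mem_inter_iff, mem_pBall_iff hp0,
          psum_rpow_smul hp0 (inv_nonneg.2 ht0.le)]
        rw [inv_mul_le_one₀ ht0]
        exact and_congr_left' (and_iff_right ht)
      rw [indicator_of_mem ht, h1, Measure.addHaar_preimage_smul _ (by positivity)]
      simp
    · have h1 : (fun x => (x, t)) ⁻¹' W = ∅ := by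
        ext x
        simp only [mem_empty_iff_false, iff_false]
        exact fun h => ht h.1.1
      rw [indicator_of_notMem ht, h1, measure_empty, zero_mul]
  have hC := measurableSet_puncturedCone (m := p) (p := (p : ℝ)) hA
  have happ := measurePreserving_append n p
  rw [← happ.measure_preimage hC.nullMeasurableSet,
    Measure.prod_apply (happ.measurable hC)]
  calc _ = ∫⁻ x, volume (pBall p (p : ℝ)) * volume (Prod.mk x ⁻¹' W) :=
        lintegral_congr hfiber
    _ = volume (pBall p (p : ℝ)) * ∫⁻ t : ℝ, volume ((fun x => (x, t)) ⁻¹' W) := by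
        rw [lintegral_const_mul _ (measurable_measure_prodMk_left hWm),
          ← Measure.prod_apply hWm, Measure.prod_apply_symm hWm]
    _ = _ := by
        have hmeas : Measurable fun t : ℝ =>
            ENNReal.ofReal |((t⁻¹ ^ (1 / (p : ℝ))) ^ n)⁻¹| := by fun_prop
        simp_rw [hslice]
        rw [lintegral_mul_const _ (hmeas.indicator measurableSet_Ioc),
          lintegral_indicator measurableSet_Ioc, coneConst, mul_assoc]

lemma volume_coneSet {n p : ℕ} (hn : 1 ≤ n) (hp : 1 ≤ p) {A : Set (Fin n → ℝ)}
    (hA : MeasurableSet A) :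
    volume (coneSet ((fun (z : Fin (n + p) → ℝ) (i : Fin n) => z (Fin.castAdd p i)) ⁻¹' A ∩
      pSphere (n + p) (p : ℝ))) = coneConst n p * volume (A ∩ pBall n (p : ℝ)) := by
  rw [measure_congr (coneSet_ae_eq hn (by exact_mod_cast hp) A), volume_puncturedCone hp hA]

lemma volume_pBall_add {n p : ℕ} (hn : 1 ≤ n) (hp : 1 ≤ p) :
    volume (pBall (n + p) (p : ℝ)) = coneConst n p * volume (pBall n (p : ℝ)) := by
  have hp0 : (0 : ℝ) < p := by exact_mod_cast hp
  have h := volume_puncturedCone (n := n) hp MeasurableSet.univ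
  rw [univ_inter] at h
  rw [← h]
  refine measure_congr ?_
  filter_upwards [ae_psum_pos (by omega) hp0] with z hN
  exact propext ((mem_pBall_iff hp0).trans ⟨fun h => ⟨⟨hN, h⟩, trivial⟩, fun h => h.1.2⟩)

/-- For integer `p ≥ 1`, the pushforward of the cone probability measure `μ_p^{n+p}` on
`𝕊_p^{n+p−1} ⊆ ℝ^{n+p}` under the orthogonal projection onto the first `n` coordinates
equals the uniform probability measure `ν_p^n` on `𝔹_p^n`. -/
theorem cone_measure_projection (n p : ℕ) (hn : 1 ≤ n) (hp : 1 ≤ p)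
    -- `μ` is the cone probability measure on `𝕊_p^{n+p-1}`:
    (μ : Measure (Fin (n + p) → ℝ))
    (hμ : ∀ A : Set (Fin (n + p) → ℝ), MeasurableSet A → A ⊆ pSphere (n + p) (p : ℝ) →
      μ A = volume (coneSet A) / volume (pBall (n + p) (p : ℝ)))
    (hμsupp : μ (pSphere (n + p) (p : ℝ))ᶜ = 0) :
    Measure.map (fun (x : Fin (n + p) → ℝ) (i : Fin n) => x (Fin.castAdd p i)) μ =
      nuMeasure n (p : ℝ) := by
  have hp1 : (1 : ℝ) ≤ p := by exact_mod_cast hp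
  have hp0 : (0 : ℝ) < p := by linarith
  have hπ : Measurable (fun (x : Fin (n + p) → ℝ) (i : Fin n) => x (Fin.castAdd p i)) := by
    fun_prop
  have hb0 := volume_pBall_ne_zero hn hp1
  have hK := volume_pBall_add hn hp
  have hK0 : coneConst n p ≠ 0 := by
    intro h
    rw [h, zero_mul] at hK
    exact volume_pBall_ne_zero (by omega) hp1 hK
  have hKtop : coneConst n p ≠ ∞ := by
    intro h
    rw [h, ENNReal.top_mul hb0] at hK
    exact volume_pBall_ne_top (by omega) hp1 hK
  ext A hA
  rw [Measure.map_apply hπ hA, ← measure_inter_conull hμsupp,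
    hμ _ ((hπ hA).inter (measurableSet_pSphere hp0)) inter_subset_right,
    volume_coneSet hn hp hA, hK, ENNReal.mul_div_mul_left _ _ hK0 hKtop, nuMeasure,
    Measure.smul_apply, Measure.restrict_apply hA, smul_eq_mul, ENNReal.div_eq_inv_mul]
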